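/- arXiv:2311.18143 — 2 statements merged into one kernel-verified Lean document; each statement's English description precedes it below -/
import Mathlib

section
/- Let k ≥ 2 be an integer and let M be the adjacency matrix of the graph T_k on 2k+4 vertices: path vertices 1, 2, …, 2k+2 with edges {i, i+1} for 1 ≤ i ≤ 2k+1, together with two extra vertices x and b, where x is adjacent to the path vertices k and k+1, and b is adjacent to the path vertex k+3. Let u = 1 and v = 2k+2. Then for all integers j ≥ 0: (M^j)_{u,u} − (M^j)_{v,v} = 2·(M^j)_{u,v}. -/
open Matrix

/-- Adjacency condition of `T_k`. -/
def tkAdj (k i j : ℕ) : Prop :=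
  ((1 ≤ i ∧ i ≤ 2 * k + 1 ∧ j = i + 1) ∨
   (1 ≤ j ∧ j ≤ 2 * k + 1 ∧ i = j + 1) ∨
   (i = 0 ∧ (j = k ∨ j = k + 1)) ∨
   (j = 0 ∧ (i = k ∨ i = k + 1)) ∨
   (i = 2 * k + 3 ∧ j = k + 3) ∨
   (j = 2 * k + 3 ∧ i = k + 3))

/-- Row `i` of the commuting matrix `Q` is `e_a + s e_b`. -/
def tkRow (k i a b : ℕ) (s : ℤ) : Prop :=
  (1 ≤ i ∧ i ≤ k ∧ a = i ∧ b + i = 2 * k + 3 ∧ s = 1) ∨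
  (k + 3 ≤ i ∧ i ≤ 2 * k + 2 ∧ a + i = 2 * k + 3 ∧ b = i ∧ s = -1) ∨
  (i = k + 1 ∧ a = 0 ∧ b = k + 2 ∧ s = 1) ∨
  (i = k + 2 ∧ a = k + 1 ∧ b = 2 * k + 3 ∧ s = -1) ∨
  (i = 0 ∧ a = k + 1 ∧ b = 2 * k + 3 ∧ s = 1) ∨
  (i = 2 * k + 3 ∧ a = 0 ∧ b = k + 2 ∧ s = -1)

theorem tkRow_exists (k : ℕ) (i : Fin (2 * k + 4)) :
    ∃ (a b : Fin (2 * k + 4)) (s : ℤ), tkRow k i a b s := by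
  obtain ⟨i, hi⟩ := i
  have h : (1 ≤ i ∧ i ≤ k) ∨ (k + 3 ≤ i ∧ i ≤ 2 * k + 2) ∨ i = k + 1 ∨ i = k + 2 ∨ i = 0 ∨
    i = 2 * k + 3 := by omega
  unfold tkRow
  rcases h with h | h | h | h | h | h
  · exact ⟨⟨i, hi⟩, ⟨2 * k + 3 - i, by omega⟩, 1, .inl ⟨h.1, h.2, rfl, by simp only; omega, rfl⟩⟩
  · exact ⟨⟨2 * k + 3 - i, by omega⟩, ⟨i, hi⟩, -1, .inr (.inl ⟨h.1, h.2, by simp only; omega, rfl, rfl⟩)⟩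
  · exact ⟨⟨0, by omega⟩, ⟨k + 2, by omega⟩, 1, .inr (.inr (.inl ⟨h, rfl, rfl, rfl⟩))⟩
  · exact ⟨⟨k + 1, by omega⟩, ⟨2 * k + 3, by omega⟩, -1, .inr (.inr (.inr (.inl ⟨h, rfl, rfl, rfl⟩)))⟩
  · exact ⟨⟨k + 1, by omega⟩, ⟨2 * k + 3, by omega⟩, 1, .inr (.inr (.inr (.inr (.inl ⟨h, rfl, rfl, rfl⟩))))⟩
  · exact ⟨⟨0, by omega⟩, ⟨k + 2, by omega⟩, -1, .inr (.inr (.inr (.inr (.inr ⟨h, rfl, rfl, rfl⟩))))⟩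

theorem tkRow_symm {k i j a b a' b' : ℕ} {s s' : ℤ} (h : tkRow k i a b s)
    (h' : tkRow k j a' b' s') :
    (if j = a then (1 : ℤ) else 0) + s * (if j = b then 1 else 0) =
      (if i = a' then 1 else 0) + s' * (if i = b' then 1 else 0) := by
  unfold tkRow at h h'
  rcases h with h | h | h | h | h | h <;> rcases h' with h' | h' | h' | h' | h' | h' <;>
    obtain ⟨rfl⟩ : s = _ := by first | exact h.2.2.2.2 | exact h.2.2.2
  all_goals obtain ⟨rfl⟩ : s' = _ := by first | exact h'.2.2.2.2 | exact h'.2.2.2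
  all_goals split_ifs <;> omega

theorem tkAdj_symm (k i j : ℕ) : tkAdj k i j ↔ tkAdj k j i := by
  unfold tkAdj
  omega

theorem tkAdj_LL {k i j : ℕ} (hk : 2 ≤ k) (hi : 1 ≤ i ∧ i ≤ k) (hj : 1 ≤ j ∧ j ≤ k) :
    tkAdj k i j ↔ j = i + 1 ∨ i = j + 1 := by
  unfold tkAdj
  omega

theorem tkAdj_RR {k i j : ℕ} (hk : 2 ≤ k) (hi : k + 3 ≤ i ∧ i ≤ 2 * k + 2) (hj : k + 3 ≤ j ∧ j ≤ 2 * k + 2) :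
    tkAdj k i j ↔ j = i + 1 ∨ i = j + 1 := by
  unfold tkAdj
  omega

theorem tkAdj_LC {k i j : ℕ} (hk : 2 ≤ k) (hi : 1 ≤ i ∧ i ≤ k) (hj : j = k + 1) :
    tkAdj k i j ↔ i = k := by
  unfold tkAdj
  omega

theorem tkAdj_CL {k i j : ℕ} (hk : 2 ≤ k) (hi : i = k + 1) (hj : 1 ≤ j ∧ j ≤ k) :
    tkAdj k i j ↔ j = k := by
  rw [tkAdj_symm]
  exact tkAdj_LC hk hj hi

theorem tkAdj_LX {k i j : ℕ} (hk : 2 ≤ k) (hi : 1 ≤ i ∧ i ≤ k) (hj : j = 0) :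
    tkAdj k i j ↔ i = k := by
  unfold tkAdj
  omega

theorem tkAdj_XL {k i j : ℕ} (hk : 2 ≤ k) (hi : i = 0) (hj : 1 ≤ j ∧ j ≤ k) :
    tkAdj k i j ↔ j = k := by
  rw [tkAdj_symm]
  exact tkAdj_LX hk hj hi

theorem tkAdj_RD {k i j : ℕ} (hk : 2 ≤ k) (hi : k + 3 ≤ i ∧ i ≤ 2 * k + 2) (hj : j = k + 2) :
    tkAdj k i j ↔ i = k + 3 := by
  unfold tkAdj
  omega

theorem tkAdj_DR {k i j : ℕ} (hk : 2 ≤ k) (hi : i = k + 2) (hj : k + 3 ≤ j ∧ j ≤ 2 * k + 2) :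
    tkAdj k i j ↔ j = k + 3 := by
  rw [tkAdj_symm]
  exact tkAdj_RD hk hj hi

theorem tkAdj_RB {k i j : ℕ} (hk : 2 ≤ k) (hi : k + 3 ≤ i ∧ i ≤ 2 * k + 2) (hj : j = 2 * k + 3) :
    tkAdj k i j ↔ i = k + 3 := by
  unfold tkAdj
  omega

theorem tkAdj_BR {k i j : ℕ} (hk : 2 ≤ k) (hi : i = 2 * k + 3) (hj : k + 3 ≤ j ∧ j ≤ 2 * k + 2) :
    tkAdj k i j ↔ j = k + 3 := by
  rw [tkAdj_symm]
  exact tkAdj_RB hk hj hi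

theorem tkAdj_CD {k i j : ℕ} (hk : 2 ≤ k) (hi : i = k + 1) (hj : j = k + 2) :
    tkAdj k i j ↔ True := by
  unfold tkAdj
  rw [iff_true]
  omega

theorem tkAdj_DC {k i j : ℕ} (hk : 2 ≤ k) (hi : i = k + 2) (hj : j = k + 1) :
    tkAdj k i j ↔ True := by
  rw [tkAdj_symm]
  exact tkAdj_CD hk hj hi

theorem tkAdj_CX {k i j : ℕ} (hk : 2 ≤ k) (hi : i = k + 1) (hj : j = 0) :
    tkAdj k i j ↔ True := by
  unfold tkAdj
  rw [iff_true]
  omega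

theorem tkAdj_XC {k i j : ℕ} (hk : 2 ≤ k) (hi : i = 0) (hj : j = k + 1) :
    tkAdj k i j ↔ True := by
  rw [tkAdj_symm]
  exact tkAdj_CX hk hj hi

theorem tkAdj_Lnone {k i j : ℕ} (hk : 2 ≤ k) (hi : 1 ≤ i ∧ i ≤ k) (hj : k + 2 ≤ j) :
    tkAdj k i j ↔ False := by
  unfold tkAdj
  rw [iff_false]
  omega

theorem tkAdj_Cnone {k i j : ℕ} (hk : 2 ≤ k) (hi : i = k + 1) (hj : (j = k + 1 ∨ k + 3 ≤ j)) :
    tkAdj k i j ↔ False := by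
  unfold tkAdj
  rw [iff_false]
  omega

theorem tkAdj_Dnone {k i j : ℕ} (hk : 2 ≤ k) (hi : i = k + 2) (hj : (j = 0 ∨ j = k + 2 ∨ j = 2 * k + 3)) :
    tkAdj k i j ↔ False := by
  unfold tkAdj
  rw [iff_false]
  omega

theorem tkAdj_Xnone {k i j : ℕ} (hk : 2 ≤ k) (hi : i = 0) (hj : (j = 0 ∨ k + 2 ≤ j)) :
    tkAdj k i j ↔ False := by
  unfold tkAdj
  rw [iff_false]
  omega

theorem tkAdj_Bnone {k i j : ℕ} (hk : 2 ≤ k) (hi : i = 2 * k + 3) (hj : (j ≤ k + 2 ∨ j = 2 * k + 3)) :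
    tkAdj k i j ↔ False := by
  unfold tkAdj
  rw [iff_false]
  omega

theorem tkAdj_Rnone {k i j : ℕ} (hk : 2 ≤ k) (hi : k + 3 ≤ i ∧ i ≤ 2 * k + 2) (hj : j ≤ k + 1) :
    tkAdj k i j ↔ False := by
  unfold tkAdj
  rw [iff_false]
  omega

theorem tkAdj_DL {k i j : ℕ} (hk : 2 ≤ k) (hi : i = k + 2) (hj : 1 ≤ j ∧ j ≤ k) :
    tkAdj k i j ↔ False := by
  unfold tkAdj
  rw [iff_false]
  omega

set_option maxHeartbeats 4000000 in
open Classical in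
theorem tkRow_comm {k i j a b a' b' : ℕ} {s s' : ℤ} (hk : 2 ≤ k) (h : tkRow k i a b s)
    (h' : tkRow k j a' b' s') :
    (if tkAdj k a j then (1 : ℤ) else 0) + s * (if tkAdj k b j then 1 else 0) =
      (if tkAdj k i a' then 1 else 0) + s' * (if tkAdj k i b' then 1 else 0) := by
  unfold tkRow at h h'
  rcases h with h | h | h | h | h | h <;> rcases h' with h' | h' | h' | h' | h' | h' <;>
    obtain ⟨rfl⟩ : s = _ := by first | exact h.2.2.2.2 | exact h.2.2.2
  all_goals obtain ⟨rfl⟩ : s' = _ := by first | exact h'.2.2.2.2 | exact h'.2.2.2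
  all_goals
    simp (disch := omega) only [tkAdj_LL hk, tkAdj_RR hk, tkAdj_LC hk, tkAdj_CL hk,
      tkAdj_LX hk, tkAdj_XL hk, tkAdj_RD hk, tkAdj_DR hk,
      tkAdj_RB hk, tkAdj_BR hk, tkAdj_CD hk, tkAdj_DC hk,
      tkAdj_CX hk, tkAdj_XC hk, tkAdj_Lnone hk, tkAdj_Cnone hk,
      tkAdj_Dnone hk, tkAdj_Xnone hk, tkAdj_Bnone hk, tkAdj_Rnone hk,
      tkAdj_DL hk, if_true, if_false] <;>
    first | (split_ifs <;> omega) | norm_num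

theorem stmt_13 (k : ℕ) (hk : 2 ≤ k)
    (M : Matrix (Fin (2 * k + 4)) (Fin (2 * k + 4)) ℝ)
    -- `M` is the adjacency matrix of `T_k`: the vertices `1,…,2k+2` form a path,
    -- vertex `0` (that is, `x`) is adjacent to path vertices `k` and `k+1`, and
    -- vertex `2k+3` (that is, `b`) is adjacent to path vertex `k+3`
    (hM : ∀ i j : Fin (2 * k + 4), M i j =
      if ((1 ≤ (i : ℕ) ∧ (i : ℕ) ≤ 2 * k + 1 ∧ (j : ℕ) = (i : ℕ) + 1) ∨
          (1 ≤ (j : ℕ) ∧ (j : ℕ) ≤ 2 * k + 1 ∧ (i : ℕ) = (j : ℕ) + 1) ∨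
          ((i : ℕ) = 0 ∧ ((j : ℕ) = k ∨ (j : ℕ) = k + 1)) ∨
          ((j : ℕ) = 0 ∧ ((i : ℕ) = k ∨ (i : ℕ) = k + 1)) ∨
          ((i : ℕ) = 2 * k + 3 ∧ (j : ℕ) = k + 3) ∨
          ((j : ℕ) = 2 * k + 3 ∧ (i : ℕ) = k + 3))
      then 1 else 0)
    (u v : Fin (2 * k + 4)) (hu : (u : ℕ) = 1) (hv : (v : ℕ) = 2 * k + 2) :
    ∀ j : ℕ, (M ^ j) u u - (M ^ j) v v = 2 * (M ^ j) u v := by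
  classical
  choose a b s hrow using tkRow_exists k
  have hM' : ∀ i j, M i j = (((if tkAdj k i j then (1 : ℤ) else 0) : ℤ) : ℝ) := by
    intro i j
    rw [hM]
    unfold tkAdj
    push_cast
    congr
  let Q : Matrix (Fin (2 * k + 4)) (Fin (2 * k + 4)) ℝ := fun i j =>
    (if j = a i then 1 else 0) + (s i : ℝ) * (if j = b i then 1 else 0)
  have hQ : ∀ i j, Q i j = (if i = a j then 1 else 0) + (s j : ℝ) * (if i = b j then 1 else 0) := by
    intro i j
    have := tkRow_symm (hrow i) (hrow j)
    simp only [← Fin.ext_iff] at this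
    have h2 := congrArg (Int.cast : ℤ → ℝ) this
    push_cast at h2
    exact h2
  have hl : ∀ (N : Matrix (Fin (2 * k + 4)) (Fin (2 * k + 4)) ℝ) i j,
      (Q * N) i j = N (a i) j + s i * N (b i) j := by
    intro N i j
    rw [Matrix.mul_apply]
    simp [Q, add_mul, Finset.sum_add_distrib]
  have hr : ∀ (N : Matrix (Fin (2 * k + 4)) (Fin (2 * k + 4)) ℝ) i j,
      (N * Q) i j = N i (a j) + s j * N i (b j) := by
    intro N i j
    simp [Matrix.mul_apply, hQ, mul_add, Finset.sum_add_distrib, mul_comm]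
  have hc : Commute Q M := by
    ext i j
    rw [hl, hr]
    simp only [hM']
    exact_mod_cast tkRow_comm hk (hrow i) (hrow j)
  intro n
  have h := congrFun (congrFun (hc.pow_right n).eq u) v
  rw [hl, hr] at h
  have h1 := hrow u
  have h2 := hrow v
  unfold tkRow at h1 h2
  have e1 : a u = u := by ext; omega
  have e2 : b u = v := by ext; omega
  have e3 : a v = u := by ext; omega
  have e4 : b v = v := by ext; omega
  have e5 : s u = 1 := by omega
  have e6 : s v = -1 := by omega
  rw [e1, e2, e3, e4, e5, e6] at h
  push_cast at h
  linarith
end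

section
/- Let M be the adjacency matrix of either S_{k,m} (with m a nonzero integer) or T_k, let K = {u, v} be the two endpoints of the underlying path, and let c = m in the case of S_{k,m} and c = 2 in the case of T_k. Let α = p/q and β = −q/p be the two roots of x − 1/x = c, and define vectors v_1, v_2 ∈ ℂ^X supported on K by v_1(u) = α, v_1(v) = 1 and v_2(u) = β, v_2(v) = 1 (zero elsewhere). Let Q be a real number transcendental over the field generated by the entries of M and α, set M^K = M + Q·D_K, and let P^K_1, P^K_2 be the minimal polynomials of M^K relative to v_1 and v_2 respectively. Then deg P^K_1 = deg P^K_2 but Tr P^K_1 ≠ Tr P^K_2 (Tr denoting the sum of the roots); in particular P^K_1 ≠ P^K_2. -/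
open Matrix

/-- `p` is the minimal polynomial of `N` relative to `w`. -/
def IsRelMinpoly {X : Type*} [Fintype X] [DecidableEq X] (N : Matrix X X ℂ) (w : X → ℂ)
    (p : Polynomial ℂ) : Prop :=
  p.Monic ∧ (Polynomial.aeval N p).mulVec w = 0 ∧
    ∀ q : Polynomial ℂ, q.Monic → (Polynomial.aeval N q).mulVec w = 0 →
      p.natDegree ≤ q.natDegree

open Polynomial in
lemma key_exists {ι : Type*} [Fintype ι] [DecidableEq ι] (N : Matrix ι ι ℂ) (w : ι → ℂ)
    (d : ℕ) (b : ℕ → ι → ℂ) (a : ℕ → ℂ) (h0 : b 0 = w)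
    (h : ∀ j < d, ∃ r : ι → ℂ, N *ᵥ b j = b (j+1) + a j • b j + r ∧
      (r = 0 ∨ ∃ p < j, ∃ g : ℂ, r = g • b p)) (j : ℕ) :
    j ≤ d → ∃ f : ℂ[X], f.Monic ∧ f.natDegree = j ∧ (aeval N f) *ᵥ w = b j ∧
      f.nextCoeff = -∑ i ∈ Finset.range j, a i := by
  induction j using Nat.strong_induction_on with
  | _ j ih =>
  intro hj
  rcases j with _ | j
  · exact ⟨1, monic_one, natDegree_one, by simp [h0], by simp [nextCoeff]⟩
  · obtain ⟨r, hr, hr'⟩ := h j (by omega)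
    obtain ⟨f, hf, hfd, hfb, hfc⟩ := ih j (by omega) (by omega)
    have hR : ∃ R : ℂ[X], R.degree < (j : ℕ) ∧ (aeval N R) *ᵥ w = r := by
      rcases hr' with rfl | ⟨p, hp, g, rfl⟩
      · exact ⟨0, by rw [degree_zero]; exact WithBot.bot_lt_coe _, by simp⟩
      · obtain ⟨q, hq, hqd, hqb, -⟩ := ih p (by omega) (by omega)
        refine ⟨g • q, ?_, ?_⟩
        · refine lt_of_le_of_lt (degree_smul_le _ _) ?_
          rw [degree_eq_natDegree hq.ne_zero, hqd]
          exact_mod_cast hp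
        · rw [map_smul, Matrix.smul_mulVec, hqb]
    obtain ⟨R, hRd, hRr⟩ := hR
    have hm : ((X - C (a j)) * f).Monic := (monic_X_sub_C _).mul hf
    have hmd : ((X - C (a j)) * f).natDegree = j + 1 := by
      rw [(monic_X_sub_C _).natDegree_mul hf, natDegree_X_sub_C, hfd]; omega
    have hlt : R.degree < ((X - C (a j)) * f).degree := by
      rw [degree_eq_natDegree hm.ne_zero, hmd]
      exact hRd.trans (by exact_mod_cast Nat.lt_succ_self j)
    have hnd : ((X - C (a j)) * f - R).natDegree = j + 1 := by
      rw [natDegree_sub_eq_left_of_natDegree_lt, hmd]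
      by_cases hR0 : R = 0
      · rw [hR0, natDegree_zero, hmd]; omega
      · exact natDegree_lt_natDegree hR0 hlt
    refine ⟨(X - C (a j)) * f - R, hm.sub_of_left hlt, hnd, ?_, ?_⟩
    · rw [map_sub, map_mul, Matrix.sub_mulVec, ← Matrix.mulVec_mulVec, hfb, hRr, map_sub,
        Matrix.sub_mulVec, aeval_X, hr, aeval_C, Algebra.algebraMap_eq_smul_one,
        Matrix.smul_mulVec, Matrix.one_mulVec]
      abel
    · have e1 : ((X - C (a j)) * f - R).nextCoeff = ((X - C (a j)) * f).nextCoeff := by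
        rw [nextCoeff_of_natDegree_pos (by omega), nextCoeff_of_natDegree_pos (by omega), hnd, hmd,
          coeff_sub]
        simp [coeff_eq_zero_of_degree_lt hRd]
      rw [e1, (monic_X_sub_C _).nextCoeff_mul hf, nextCoeff_X_sub_C, hfc, Finset.sum_range_succ]
      ring

open Polynomial in
lemma key {ι : Type*} [Fintype ι] [DecidableEq ι] (N : Matrix ι ι ℂ) (w : ι → ℂ)
    (d : ℕ) (b : ℕ → ι → ℂ) (a : ℕ → ℂ) (l : ℕ → (ι → ℂ) →ₗ[ℂ] ℂ) (hd0 : 0 < d) (h0 : b 0 = w)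
    (hd : b d = 0)
    (h : ∀ j < d, ∃ r : ι → ℂ, N *ᵥ b j = b (j+1) + a j • b j + r ∧
      (r = 0 ∨ ∃ p < j, ∃ g : ℂ, r = g • b p))
    (hl : ∀ e < d, l e (b e) ≠ 0 ∧ ∀ j < e, l e (b j) = 0)
    (P : ℂ[X]) (hP : IsRelMinpoly N w P) :
    P.natDegree = d ∧ P.coeff (P.natDegree - 1) = -∑ i ∈ Finset.range d, a i := by
  obtain ⟨hPm, hPz, hPmin⟩ := hP
  have ex := key_exists N w d b a h0 h
  have low : ∀ e < d, ∀ s : ℕ, s ≤ e → ∀ q : ℂ[X], q.degree < (s : ℕ) →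
      l e ((aeval N q) *ᵥ w) = 0 := by
    intro e he s
    induction s with
    | zero =>
      intro _ q hq
      have : q = 0 := by
        rw [← degree_eq_bot]
        exact Nat.WithBot.lt_zero_iff.1 hq
      simp [this]
    | succ s ih =>
      intro hs q hq
      obtain ⟨f, hf, hfd, hfb, -⟩ := ex s (by omega)
      have hq' : (q - C (q.coeff s) * f).degree < (s : ℕ) := by
        rw [degree_lt_iff_coeff_zero]
        intro t ht
        rcases Nat.eq_or_lt_of_le ht with rfl | ht
        · have : f.coeff s = 1 := by rw [← hfd]; exact hf
          simp [this]
        · rw [coeff_sub, coeff_C_mul, coeff_eq_zero_of_natDegree_lt (p := f) (by omega),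
            (degree_lt_iff_coeff_zero _ _).1 hq t (by omega)]
          simp
      have := ih (by omega) _ hq'
      rw [map_sub, map_mul, aeval_C, Algebra.algebraMap_eq_smul_one, smul_mul_assoc, one_mul,
        Matrix.sub_mulVec, Matrix.smul_mulVec, hfb, map_sub, map_smul,
        (hl e he).2 s (by omega)] at this
      simpa using this
  obtain ⟨f, hf, hfd, hfb, hfc⟩ := ex d le_rfl
  have hle : P.natDegree ≤ d := hfd ▸ hPmin f hf (by rw [hfb, hd])
  have hmon : ∀ q : ℂ[X], q.Monic → (aeval N q) *ᵥ w = 0 → d ≤ q.natDegree := by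
    intro q hq hz
    by_contra! hlt
    obtain ⟨f, hf, hfd, hfb, -⟩ := ex q.natDegree hlt.le
    have := low _ hlt _ le_rfl (q - f) (by
      rw [← degree_eq_natDegree hq.ne_zero]
      apply degree_sub_lt_left _ hq.ne_zero
      · rw [hq.leadingCoeff, hf.leadingCoeff]
      · rw [degree_eq_natDegree hq.ne_zero, degree_eq_natDegree hf.ne_zero, hfd])
    rw [map_sub, Matrix.sub_mulVec, hz, hfb, zero_sub, map_neg, neg_eq_zero] at this
    exact (hl _ hlt).1 this
  have hPd : P.natDegree = d := le_antisymm hle (hmon P hPm hPz)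
  have hPf : P = f := by
    by_contra hne
    have hne' : P - f ≠ 0 := sub_ne_zero.2 hne
    have hdl : (P - f).degree < P.degree := by
      apply degree_sub_lt_left _ hPm.ne_zero
      · rw [hPm.leadingCoeff, hf.leadingCoeff]
      · rw [degree_eq_natDegree hPm.ne_zero, degree_eq_natDegree hf.ne_zero, hfd, hPd]
    have h1 := hmon ((P - f) * C (P - f).leadingCoeff⁻¹) (monic_mul_leadingCoeff_inv hne') (by
      rw [mul_comm, map_mul, aeval_C, Algebra.algebraMap_eq_smul_one, smul_mul_assoc, one_mul,
        map_sub, Matrix.smul_mulVec, Matrix.sub_mulVec, hPz, hfb, hd]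
      simp)
    rw [natDegree_mul_leadingCoeff_inv _ hne'] at h1
    have h2 := natDegree_lt_natDegree hne' hdl
    omega
  refine ⟨hPd, ?_⟩
  rw [← nextCoeff_of_natDegree_pos (by omega), hPf, hfc]

/-- Coordinate vector indexed by a natural number. -/
def EE (n : ℕ) (i : ℕ) : Fin n → ℂ := fun x => if (x : ℕ) = i then 1 else 0

lemma mulVec_EE {n : ℕ} (N : Matrix (Fin n) (Fin n) ℂ) (i : ℕ) (hi : i < n) (x : Fin n) :
    ∃ y : Fin n, (y : ℕ) = i ∧ (N *ᵥ EE n i) x = N x y := by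
  refine ⟨⟨i, hi⟩, rfl, ?_⟩
  have : EE n i = Pi.single (⟨i, hi⟩ : Fin n) 1 := by
    ext y
    simp [EE, Pi.single_apply, Fin.ext_iff]
  rw [this]; simp

lemma S_case (k : ℕ) (m : ℂ) (Q : ℂ) (hk : 1 ≤ k)
    (N : Matrix (Fin (2*k+2)) (Fin (2*k+2)) ℂ)
    (hN : ∀ i j : Fin (2*k+2), N i j =
          (if (i : ℕ) + 1 = (j : ℕ) ∨ (j : ℕ) + 1 = (i : ℕ) then 1 else 0) +
          (if (i : ℕ) = k ∧ (j : ℕ) = k then m else 0) +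
          (if (i : ℕ) = j ∧ ((i : ℕ) = 0 ∨ (i : ℕ) = 2*k+1) then Q else 0))
    (r : ℂ) (hr0 : r ≠ 0) (hr : r^2 = m * r + 1)
    (w : Fin (2*k+2) → ℂ)
    (hw : w = fun x : Fin _ => if (x : ℕ) = 0 then r else if (x : ℕ) = 2*k+1 then 1 else 0)
    (P : Polynomial ℂ) (hP : IsRelMinpoly N w P) :
    P.natDegree = k + 1 ∧ P.coeff (P.natDegree - 1) = -(Q + r) := by
  have E0 : N *ᵥ EE _ 0 = EE _ 1 + Q • EE _ 0 := by
    ext x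
    obtain ⟨y, hy, hxy⟩ := mulVec_EE N 0 (by omega) x
    rw [hxy, hN]
    simp only [EE, Pi.add_apply, Pi.smul_apply, smul_eq_mul]
    split_ifs <;> first | contradiction | omega | simp
  have E1 : N *ᵥ EE _ (2*k+1) = EE _ (2*k) + Q • EE _ (2*k+1) := by
    ext x
    obtain ⟨y, hy, hxy⟩ := mulVec_EE N (2*k+1) (by omega) x
    rw [hxy, hN]
    simp only [EE, Pi.add_apply, Pi.smul_apply, smul_eq_mul]
    split_ifs <;> first | contradiction | omega | simp
  have E2 : ∀ i, i + 1 < 2*k+1 → i + 1 ≠ k → N *ᵥ EE _ (i+1) = EE _ i + EE _ (i+2) := by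
    intro i h1 h2
    ext x
    obtain ⟨y, hy, hxy⟩ := mulVec_EE N (i+1) (by omega) x
    rw [hxy, hN]
    simp only [EE, Pi.add_apply]
    split_ifs <;> first | contradiction | omega | simp
  have E3 : N *ᵥ EE _ k = EE _ (k-1) + EE _ (k+1) + m • EE _ k := by
    ext x
    obtain ⟨y, hy, hxy⟩ := mulVec_EE N k (by omega) x
    rw [hxy, hN]
    simp only [EE, Pi.add_apply, Pi.smul_apply, smul_eq_mul]
    split_ifs <;> first | contradiction | omega | simp
  obtain ⟨b, hb⟩ : ∃ b : ℕ → Fin (2*k+2) → ℂ,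
    b = fun j => if j ≤ k then r • EE _ j + EE _ (2*k+1-j) else 0 := ⟨_, rfl⟩
  have hb1 : ∀ j ≤ k, b j = r • EE _ j + EE _ (2*k+1-j) := by
    intro j hj; rw [hb]; simp [hj]
  have hb2 : b (k+1) = 0 := by rw [hb]; simp
  obtain ⟨h1, h2⟩ := key N w (k+1) b (fun i => (if i = 0 then Q else 0) + (if i = k then r else 0))
    (fun e => LinearMap.proj (if h : e < 2*k+2 then (⟨e, h⟩ : Fin (2*k+2)) else ⟨0, by omega⟩))
    (by omega) (by
      rw [hb1 0 (by omega), hw]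
      ext x
      simp only [EE, Pi.add_apply, Pi.smul_apply, smul_eq_mul]
      split_ifs <;> first | contradiction | omega | simp) hb2 (by
      intro j hj
      rcases Nat.eq_zero_or_pos j with rfl | hj0
      · refine ⟨0, ?_, Or.inl rfl⟩
        rw [hb1 0 (by omega), hb1 (0+1) (by omega), Matrix.mulVec_add, Matrix.mulVec_smul,
          if_pos rfl, if_neg (by omega), show 2*k+1-0 = 2*k+1 by omega,
          show 2*k+1-(0+1) = 2*k by omega, E0, E1]
        module
      · refine ⟨b (j-1), ?_, Or.inr ⟨j-1, by omega, 1, by simp⟩⟩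
        obtain ⟨i, rfl⟩ : ∃ i, j = i + 1 := ⟨j-1, by omega⟩
        rw [hb1 (i+1) (by omega), Matrix.mulVec_add, Matrix.mulVec_smul, if_neg (by omega)]
        rcases Nat.lt_or_ge (i+1) k with hlt | hge
        · rw [hb1 (i+1+1) (by omega), hb1 (i+1-1) (by omega), if_neg (by omega),
            E2 i (by omega) (by omega), show 2*k+1-(i+1) = 2*k-i-1+1 by omega,
            E2 (2*k-i-1) (by omega) (by omega), show 2*k+1-(i+1+1) = 2*k-i-1 by omega,
            show 2*k+1-(i+1-1) = 2*k-i-1+2 by omega, show i+1-1 = i by omega]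
          module
        · have hik : i + 1 = k := by omega
          rw [hik, hb2, hb1 (k-1) (by omega), if_pos rfl, E3,
            show 2*k+1-k = k+1 by omega, E2 k (by omega) (by omega),
            show 2*k+1-(k-1) = k+2 by omega]
          have : r * r = m * r + 1 := by rw [← hr]; ring
          simp only [smul_add, smul_smul, zero_add, this]
          module) (by
      intro e he
      have hlt : e < 2*k+2 := by omega
      simp only [hlt, dite_true, LinearMap.proj_apply]
      refine ⟨?_, fun j hj => ?_⟩
      · rw [hb1 e (by omega)]
        simp only [EE, Pi.add_apply, Pi.smul_apply, smul_eq_mul]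
        rw [if_pos trivial, if_neg (by omega)]
        simpa using hr0
      · rw [hb1 j (by omega)]
        simp only [EE, Pi.add_apply, Pi.smul_apply, smul_eq_mul]
        rw [if_neg (by omega), if_neg (by omega)]
        simp) P hP
  refine ⟨h1, ?_⟩
  rw [h2, Finset.sum_add_distrib]
  simp

set_option linter.unusedSimpArgs false in
set_option maxHeartbeats 4000000 in
lemma T_case (k : ℕ) (Q : ℂ) (hk : 2 ≤ k)
    (N : Matrix (Fin (2*k+4)) (Fin (2*k+4)) ℂ)
    (hN : ∀ i j : Fin (2*k+4), N i j =
          (if ((1 ≤ (i : ℕ) ∧ (i : ℕ) ≤ 2 * k + 1 ∧ (j : ℕ) = (i : ℕ) + 1) ∨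
              (1 ≤ (j : ℕ) ∧ (j : ℕ) ≤ 2 * k + 1 ∧ (i : ℕ) = (j : ℕ) + 1) ∨
              ((i : ℕ) = 0 ∧ ((j : ℕ) = k ∨ (j : ℕ) = k + 1)) ∨
              ((j : ℕ) = 0 ∧ ((i : ℕ) = k ∨ (i : ℕ) = k + 1)) ∨
              ((i : ℕ) = 2 * k + 3 ∧ (j : ℕ) = k + 3) ∨
              ((j : ℕ) = 2 * k + 3 ∧ (i : ℕ) = k + 3))
          then 1 else 0) +
          (if (i : ℕ) = j ∧ ((i : ℕ) = 1 ∨ (i : ℕ) = 2*k+2) then Q else 0))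
    (r : ℂ) (hr0 : r ≠ 0) (hr : r^2 = 2 * r + 1)
    (w : Fin (2*k+4) → ℂ)
    (hw : w = fun x : Fin _ => if (x : ℕ) = 1 then r else if (x : ℕ) = 2*k+2 then 1 else 0)
    (P : Polynomial ℂ) (hP : IsRelMinpoly N w P) :
    P.natDegree = k + 2 ∧ P.coeff (P.natDegree - 1) = -(Q + (1 + 1/r)) := by
  have E0 : N *ᵥ EE _ 1 = EE _ 2 + Q • EE _ 1 := by
    ext x
    obtain ⟨y, hy, hxy⟩ := mulVec_EE N 1 (by omega) x
    rw [hxy, hN]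
    simp only [EE, Pi.add_apply, Pi.smul_apply, smul_eq_mul]
    split_ifs <;> first | contradiction | omega | simp
  have E1 : N *ᵥ EE _ (2*k+2) = EE _ (2*k+1) + Q • EE _ (2*k+2) := by
    ext x
    obtain ⟨y, hy, hxy⟩ := mulVec_EE N (2*k+2) (by omega) x
    rw [hxy, hN]
    simp only [EE, Pi.add_apply, Pi.smul_apply, smul_eq_mul]
    split_ifs <;> first | contradiction | omega | simp
  have E2 : ∀ i, 1 ≤ i → i + 1 < 2*k+2 → i + 1 ≠ k → i ≠ k → i + 1 ≠ k + 3 →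
      N *ᵥ EE _ (i+1) = EE _ i + EE _ (i+2) := by
    intro i h1 h2 h3 h4 h5
    ext x
    obtain ⟨y, hy, hxy⟩ := mulVec_EE N (i+1) (by omega) x
    rw [hxy, hN]
    simp only [EE, Pi.add_apply]
    split_ifs <;> first | contradiction | omega | simp
  have E3 : N *ᵥ EE _ k = EE _ (k-1) + EE _ (k+1) + EE _ 0 := by
    ext x
    obtain ⟨y, hy, hxy⟩ := mulVec_EE N k (by omega) x
    rw [hxy, hN]
    simp only [EE, Pi.add_apply, Pi.smul_apply, smul_eq_mul]
    split_ifs <;> first | contradiction | omega | simp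
  have E4 : N *ᵥ EE _ (k+1) = EE _ k + EE _ (k+2) + EE _ 0 := by
    ext x
    obtain ⟨y, hy, hxy⟩ := mulVec_EE N (k+1) (by omega) x
    rw [hxy, hN]
    simp only [EE, Pi.add_apply, Pi.smul_apply, smul_eq_mul]
    split_ifs <;> first | contradiction | omega | simp
  have E5 : N *ᵥ EE _ (k+2) = EE _ (k+1) + EE _ (k+3) :=
    E2 (k+1) (by omega) (by omega) (by omega) (by omega) (by omega)
  have E6 : N *ᵥ EE _ (k+3) = EE _ (k+2) + EE _ (k+4) + EE _ (2*k+3) := by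
    ext x
    obtain ⟨y, hy, hxy⟩ := mulVec_EE N (k+3) (by omega) x
    rw [hxy, hN]
    simp only [EE, Pi.add_apply, Pi.smul_apply, smul_eq_mul]
    split_ifs <;> first | contradiction | omega | simp
  have E7 : N *ᵥ EE _ 0 = EE _ k + EE _ (k+1) := by
    ext x
    obtain ⟨y, hy, hxy⟩ := mulVec_EE N 0 (by omega) x
    rw [hxy, hN]
    simp only [EE, Pi.add_apply, Pi.smul_apply, smul_eq_mul]
    split_ifs <;> first | contradiction | omega | simp
  have E8 : N *ᵥ EE _ (2*k+3) = EE _ (k+3) := by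
    ext x
    obtain ⟨y, hy, hxy⟩ := mulVec_EE N (2*k+3) (by omega) x
    rw [hxy, hN]
    simp only [EE, Pi.add_apply, Pi.smul_apply, smul_eq_mul]
    split_ifs <;> first | contradiction | omega | simp
  obtain ⟨b, hb⟩ : ∃ b : ℕ → Fin (2*k+4) → ℂ,
    b = fun j => if j < k then r • EE _ (j+1) + EE _ (2*k+2-j) else
      if j = k then r • EE _ (k+1) + r • EE _ 0 + EE _ (k+2) + EE _ (2*k+3) else
      if j = k+1 then (r+1) • EE _ (k+1) + r • EE _ 0 + r • EE _ (k+2) else 0 := ⟨_, rfl⟩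
  have hb1 : ∀ j < k, b j = r • EE _ (j+1) + EE _ (2*k+2-j) := by
    intro j hj; rw [hb]; simp [hj]
  have hb2 : b k = r • EE _ (k+1) + r • EE _ 0 + EE _ (k+2) + EE _ (2*k+3) := by rw [hb]; simp
  have hb3 : b (k+1) = (r+1) • EE _ (k+1) + r • EE _ 0 + r • EE _ (k+2) := by rw [hb]; simp
  have hb4 : b (k+2) = 0 := by rw [hb]; simp
  obtain ⟨h1, h2⟩ := key N w (k+2) b
    (fun i => (if i = 0 then Q else 0) + (if i = k+1 then 1+1/r else 0))
    (fun e => if h : e < k then LinearMap.proj (⟨e+1, by omega⟩ : Fin (2*k+4)) else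
      if e = k then LinearMap.proj (⟨2*k+3, by omega⟩ : Fin (2*k+4)) else
      LinearMap.proj (⟨0, by omega⟩ : Fin (2*k+4)) -
        r • LinearMap.proj (⟨2*k+3, by omega⟩ : Fin (2*k+4)))
    (by omega) (by
      rw [hb1 0 (by omega), hw]
      ext x
      simp only [EE, Pi.add_apply, Pi.smul_apply, smul_eq_mul]
      split_ifs <;> first | contradiction | omega | simp) hb4 (by
      intro j hj
      rcases Nat.eq_zero_or_pos j with rfl | hj0
      · refine ⟨0, ?_, Or.inl rfl⟩
        rw [hb1 0 (by omega), hb1 (0+1) (by omega), Matrix.mulVec_add, Matrix.mulVec_smul,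
          if_pos rfl, if_neg (by omega), show 2*k+2-0 = 2*k+2 by omega,
          show 2*k+2-(0+1) = 2*k+1 by omega, show 0+1 = 1 by omega, E0, E1]
        module
      rcases Nat.lt_or_ge (j+1) k with hlt | hge
      · refine ⟨b (j-1), ?_, Or.inr ⟨j-1, by omega, 1, by simp⟩⟩
        obtain ⟨i, rfl⟩ : ∃ i, j = i + 1 := ⟨j-1, by omega⟩
        rw [hb1 (i+1) (by omega), Matrix.mulVec_add, Matrix.mulVec_smul, if_neg (by omega),
            hb1 (i+1+1) (by omega), hb1 (i+1-1) (by omega), if_neg (by omega),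
            E2 (i+1) (by omega) (by omega) (by omega) (by omega) (by omega),
            show 2*k+2-(i+1) = 2*k-i+1 by omega,
            E2 (2*k-i) (by omega) (by omega) (by omega) (by omega) (by omega),
            show 2*k+2-(i+1+1) = 2*k-i by omega,
            show 2*k+2-(i+1-1) = 2*k-i+2 by omega, show i+1-1+1 = i+1 by omega]
        module
      rcases Nat.eq_or_lt_of_le hge with hge | hge
      · refine ⟨b (j-1), ?_, Or.inr ⟨j-1, by omega, 1, by simp⟩⟩
        rw [hb1 j (by omega), ← hge, hb2, hb1 (j-1) (by omega), Matrix.mulVec_add,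
          Matrix.mulVec_smul, if_neg (by omega), if_neg (by omega), E3,
          show 2*k+2-j = k+3 by omega, E6, show 2*k+2-(j-1) = k+4 by omega,
          show j-1+1 = k-1 by omega]
        module
      have hrr : r * r = 2 * r + 1 := by rw [← hr]; ring
      rcases Nat.eq_or_lt_of_le hge with hge | hge
      · obtain rfl : j = k := by omega
        refine ⟨(2:ℂ) • b (j-1), ?_, Or.inr ⟨j-1, by omega, 2, rfl⟩⟩
        rw [hb2, hb3, hb1 (j-1) (by omega), if_neg (by omega), if_neg (by omega),
          show 2*j+2-(j-1) = j+3 by omega, show j-1+1 = j by omega]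
        simp only [Matrix.mulVec_add, Matrix.mulVec_smul, E4, E5, E7, E8]
        module
      · obtain rfl : j = k+1 := by omega
        refine ⟨r • b (k-1), ?_, Or.inr ⟨k-1, by omega, r, rfl⟩⟩
        rw [hb3, hb4, hb1 (k-1) (by omega), if_neg (by omega), if_pos rfl,
          show 2*k+2-(k-1) = k+3 by omega, show k-1+1 = k by omega]
        simp only [Matrix.mulVec_add, Matrix.mulVec_smul, E4, E5, E7]
        have e1 : (0 + (1 + 1/r)) * (r+1) = 2 * r := by
          field_simp; linear_combination -hrr
        have e2 : (0 + (1 + 1/r)) * r = r + 1 := by rw [zero_add]; field_simp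
        simp only [smul_add, smul_smul, hrr, e1, e2]
        module) (by
      intro e he
      rcases Nat.lt_or_ge e k with hlt | hge
      · simp only [hlt, dite_true, LinearMap.proj_apply]
        refine ⟨?_, fun j hj => ?_⟩
        · rw [hb1 e (by omega)]
          simp only [EE, Pi.add_apply, Pi.smul_apply, smul_eq_mul]
          rw [if_pos trivial, if_neg (by omega)]
          simpa using hr0
        · rw [hb1 j (by omega)]
          simp only [EE, Pi.add_apply, Pi.smul_apply, smul_eq_mul]
          rw [if_neg (by omega), if_neg (by omega)]
          simp
      rcases Nat.eq_or_lt_of_le hge with rfl | hge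
      · rw [dif_neg (by omega), if_pos rfl]
        simp only [LinearMap.proj_apply]
        refine ⟨?_, fun j hj => ?_⟩
        · rw [hb2]
          simp only [EE, Pi.add_apply, Pi.smul_apply, smul_eq_mul]
          rw [if_neg (by omega), if_neg (by omega), if_neg (by omega), if_pos trivial]
          simp
        · rw [hb1 j (by omega)]
          simp only [EE, Pi.add_apply, Pi.smul_apply, smul_eq_mul]
          rw [if_neg (by omega), if_neg (by omega)]
          simp
      · obtain rfl : e = k+1 := by omega
        rw [dif_neg (by omega), if_neg (by omega)]
        simp only [LinearMap.proj_apply, LinearMap.sub_apply, LinearMap.smul_apply, smul_eq_mul]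
        refine ⟨?_, fun j hj => ?_⟩
        · rw [hb3]
          have n1 : ¬ (2*k+3 = k+1) := by omega
          have n2 : ¬ (2*k+3 = k+2) := by omega
          simp only [EE, Pi.add_apply, Pi.smul_apply, smul_eq_mul, if_neg n1, if_neg n2]
          simpa using hr0
        · rcases Nat.eq_or_lt_of_le (Nat.le_of_lt_succ hj) with rfl | hj
          · rw [hb2]
            simp only [EE, Pi.add_apply, Pi.smul_apply, smul_eq_mul]
            split_ifs <;> first | contradiction | omega | simp
          · rw [hb1 j (by omega)]
            simp only [EE, Pi.add_apply, Pi.smul_apply, smul_eq_mul]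
            split_ifs <;> first | contradiction | omega | simp) P hP
  refine ⟨h1, ?_⟩
  rw [h2, Finset.sum_add_distrib]
  simp

theorem stmt_14 (n k : ℕ) (m : ℤ) (c : ℝ)
    (M : Matrix (Fin n) (Fin n) ℝ) (u v : Fin n)
    -- `M` is the adjacency matrix of `S_{k,m}` (with `c = m ≠ 0`) or of `T_k` (with `c = 2`),
    -- `u, v` being the endpoints of the underlying path
    (hcase :
      (n = 2 * k + 2 ∧ 1 ≤ k ∧ m ≠ 0 ∧ c = (m : ℝ) ∧ (u : ℕ) = 0 ∧ (v : ℕ) = 2 * k + 1 ∧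
        ∀ i j : Fin n, M i j =
          (if (i : ℕ) + 1 = (j : ℕ) ∨ (j : ℕ) + 1 = (i : ℕ) then 1 else 0) +
          (if (i : ℕ) = k ∧ (j : ℕ) = k then (m : ℝ) else 0)) ∨
      (n = 2 * k + 4 ∧ 2 ≤ k ∧ c = 2 ∧ (u : ℕ) = 1 ∧ (v : ℕ) = 2 * k + 2 ∧
        ∀ i j : Fin n, M i j =
          if ((1 ≤ (i : ℕ) ∧ (i : ℕ) ≤ 2 * k + 1 ∧ (j : ℕ) = (i : ℕ) + 1) ∨
              (1 ≤ (j : ℕ) ∧ (j : ℕ) ≤ 2 * k + 1 ∧ (i : ℕ) = (j : ℕ) + 1) ∨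
              ((i : ℕ) = 0 ∧ ((j : ℕ) = k ∨ (j : ℕ) = k + 1)) ∨
              ((j : ℕ) = 0 ∧ ((i : ℕ) = k ∨ (i : ℕ) = k + 1)) ∨
              ((i : ℕ) = 2 * k + 3 ∧ (j : ℕ) = k + 3) ∨
              ((j : ℕ) = 2 * k + 3 ∧ (i : ℕ) = k + 3))
          then 1 else 0))
    -- `α = p/q` and `β = −q/p` are the two roots of `x − 1/x = c`
    (α β : ℝ) (hαβ : α ≠ β) (hα : α - 1 / α = c) (hβ : β - 1 / β = c)
    -- `v₁, v₂` are the corresponding vectors supported on `K = {u, v}`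
    (v₁ v₂ : Fin n → ℂ)
    (hv₁ : v₁ = fun x => if x = u then (α : ℂ) else if x = v then 1 else 0)
    (hv₂ : v₂ = fun x => if x = u then (β : ℂ) else if x = v then 1 else 0)
    -- `Q` is transcendental over the field generated by the entries of `M` and `α`
    (F : Subfield ℂ)
    (hF : F = Subfield.closure
      ((Set.range fun p : Fin n × Fin n => ((M p.1 p.2 : ℝ) : ℂ)) ∪ {(α : ℂ)}))
    (Q : ℝ) (hQ : Transcendental F ((Q : ℂ)))
    -- `P₁, P₂` are the minimal polynomials of `M^K = M + Q·D_K` relative to `v₁, v₂`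
    (P₁ P₂ : Polynomial ℂ)
    (hP₁ : IsRelMinpoly
      ((M.map (Complex.ofReal)) +
        (Q : ℂ) • Matrix.diagonal (fun x => if x = u ∨ x = v then (1 : ℂ) else 0)) v₁ P₁)
    (hP₂ : IsRelMinpoly
      ((M.map (Complex.ofReal)) +
        (Q : ℂ) • Matrix.diagonal (fun x => if x = u ∨ x = v then (1 : ℂ) else 0)) v₂ P₂) :
    P₁.natDegree = P₂.natDegree ∧
    -(P₁.coeff (P₁.natDegree - 1)) ≠ -(P₂.coeff (P₂.natDegree - 1)) ∧
    P₁ ≠ P₂ := by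
  rcases hcase with ⟨rfl, hk, hm, hc, hu, hv, hM⟩ | ⟨rfl, hk, hc, hu, hv, hM⟩
  · have hmR : (m : ℝ) ≠ 0 := by exact_mod_cast hm
    have aux : ∀ r : ℝ, r - 1 / r = c → (r : ℂ) ≠ 0 ∧ (r : ℂ)^2 = (m : ℂ) * r + 1 := by
      intro r hr
      have hr0 : r ≠ 0 := by
        rintro rfl
        apply hmR; rw [← hc, ← hr]; simp
      refine ⟨by exact_mod_cast hr0, ?_⟩
      have : r^2 = m * r + 1 := by
        rw [← hc, ← hr]; field_simp; ring
      exact_mod_cast this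
    have hN : ∀ i j : Fin (2*k+2), ((M.map (Complex.ofReal)) +
        (Q : ℂ) • Matrix.diagonal (fun x => if x = u ∨ x = v then (1 : ℂ) else 0)) i j =
          (if (i : ℕ) + 1 = (j : ℕ) ∨ (j : ℕ) + 1 = (i : ℕ) then 1 else 0) +
          (if (i : ℕ) = k ∧ (j : ℕ) = k then (m : ℂ) else 0) +
          (if (i : ℕ) = j ∧ ((i : ℕ) = 0 ∨ (i : ℕ) = 2*k+1) then (Q : ℂ) else 0) := by
      intro i j
      simp only [Matrix.add_apply, Matrix.map_apply, Matrix.smul_apply, Matrix.diagonal_apply, hM,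
        Fin.ext_iff, hu, hv, smul_eq_mul]
      congr 1
      · split_ifs <;> simp
      · by_cases h1 : (i : ℕ) = j <;> simp [h1]
    simp only [Fin.ext_iff, hu, hv] at hv₁ hv₂
    obtain ⟨a1, a2⟩ := S_case k m Q hk _ hN α (aux α hα).1 (aux α hα).2 v₁ hv₁ P₁ hP₁
    obtain ⟨b1, b2⟩ := S_case k m Q hk _ hN β (aux β hβ).1 (aux β hβ).2 v₂ hv₂ P₂ hP₂
    have hne : -(P₁.coeff (P₁.natDegree - 1)) ≠ -(P₂.coeff (P₂.natDegree - 1)) := by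
      rw [a2, b2]
      intro h
      apply hαβ
      have : (α : ℂ) = β := by linear_combination h
      exact_mod_cast this
    exact ⟨by rw [a1, b1], hne, fun h => hne (by rw [h])⟩
  · have aux : ∀ r : ℝ, r - 1 / r = c → (r : ℂ) ≠ 0 ∧ (r : ℂ)^2 = 2 * r + 1 := by
      intro r hr
      have hr0 : r ≠ 0 := by
        rintro rfl
        rw [hc] at hr; norm_num at hr
      refine ⟨by exact_mod_cast hr0, ?_⟩
      have : r^2 = 2 * r + 1 := by
        rw [← hc, ← hr]; field_simp; ring
      exact_mod_cast this
    have hN : ∀ i j : Fin (2*k+4), ((M.map (Complex.ofReal)) +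
        (Q : ℂ) • Matrix.diagonal (fun x => if x = u ∨ x = v then (1 : ℂ) else 0)) i j =
          (if ((1 ≤ (i : ℕ) ∧ (i : ℕ) ≤ 2 * k + 1 ∧ (j : ℕ) = (i : ℕ) + 1) ∨
              (1 ≤ (j : ℕ) ∧ (j : ℕ) ≤ 2 * k + 1 ∧ (i : ℕ) = (j : ℕ) + 1) ∨
              ((i : ℕ) = 0 ∧ ((j : ℕ) = k ∨ (j : ℕ) = k + 1)) ∨
              ((j : ℕ) = 0 ∧ ((i : ℕ) = k ∨ (i : ℕ) = k + 1)) ∨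
              ((i : ℕ) = 2 * k + 3 ∧ (j : ℕ) = k + 3) ∨
              ((j : ℕ) = 2 * k + 3 ∧ (i : ℕ) = k + 3))
          then 1 else 0) +
          (if (i : ℕ) = j ∧ ((i : ℕ) = 1 ∨ (i : ℕ) = 2*k+2) then (Q : ℂ) else 0) := by
      intro i j
      simp only [Matrix.add_apply, Matrix.map_apply, Matrix.smul_apply, Matrix.diagonal_apply, hM,
        Fin.ext_iff, hu, hv, smul_eq_mul]
      congr 1
      · split_ifs <;> simp
      · by_cases h1 : (i : ℕ) = j <;> simp [h1]
    simp only [Fin.ext_iff, hu, hv] at hv₁ hv₂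
    obtain ⟨a1, a2⟩ := T_case k Q hk _ hN α (aux α hα).1 (aux α hα).2 v₁ hv₁ P₁ hP₁
    obtain ⟨b1, b2⟩ := T_case k Q hk _ hN β (aux β hβ).1 (aux β hβ).2 v₂ hv₂ P₂ hP₂
    have hne : -(P₁.coeff (P₁.natDegree - 1)) ≠ -(P₂.coeff (P₂.natDegree - 1)) := by
      rw [a2, b2]
      intro h
      apply hαβ
      have h2 : (1 / (α : ℂ)) = 1 / (β : ℂ) := by linear_combination h
      have : (α : ℂ) = β := by simpa using h2
      exact_mod_cast this
    exact ⟨by rw [a1, b1], hne, fun h => hne (by rw [h])⟩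
end
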